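/- For every m ≥ 1, every σ ∈ Σ_{m+1}, and every 0 ≤ j ≤ m, the genus of a face satisfies S_1(σ) − 1 ≤ S_1(∂_j(σ)) ≤ S_1(σ). -/

import Mathlib

open Equiv

/-- The `j`-th face of a permutation of `Fin (n+1)`: delete the entry `σ j` from the
one-line notation and decrease by one every remaining entry exceeding `σ j`. -/
def permFace {n : ℕ} (σ : Equiv.Perm (Fin (n + 1))) (j : Fin (n + 1)) :
    Equiv.Perm (Fin n) :=
  (finSuccAboveEquiv j).trans
    ((σ.subtypeEquiv (fun a => (σ.injective.ne_iff (x := a) (y := j)).symm)).trans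
      (finSuccAboveEquiv (σ j)).symm)

/-- The hat `σ̂ ∈ Σ_{n+1}` of `σ ∈ Σ_n`: `σ̂ 0 = 0` and `σ̂ (j+1) = σ j + 1`. -/
def permHat {n : ℕ} (σ : Equiv.Perm (Fin n)) : Equiv.Perm (Fin (n + 1)) :=
  (finSuccEquiv n).symm.permCongr σ.optionCongr

/-- The alternating-sum boundary map `∂ : ℤΣ_{n+1} → ℤΣ_n`. -/
def permBdry (n : ℕ) :
    FreeAbelianGroup (Equiv.Perm (Fin (n + 1))) →+ FreeAbelianGroup (Equiv.Perm (Fin n)) :=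
  FreeAbelianGroup.lift fun σ =>
    ∑ j : Fin (n + 1), (-1 : ℤ) ^ (j : ℕ) • FreeAbelianGroup.of (permFace σ j)

/-- The linear extension `D : ℤΣ_n → ℤΣ_{n+1}` of the hat operation. -/
def permHatMap (n : ℕ) :
    FreeAbelianGroup (Equiv.Perm (Fin n)) →+ FreeAbelianGroup (Equiv.Perm (Fin (n + 1))) :=
  FreeAbelianGroup.lift fun σ => FreeAbelianGroup.of (permHat σ)

/-- The number of orbits (cycles, counting fixed points) of a permutation of `Fin m`. -/
def permCyc {m : ℕ} (π : Equiv.Perm (Fin m)) : ℕ :=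
  π.cycleType.card + (Finset.univ.filter fun x => π x = x).card

/-- The genus `S_2(σ) = (m − Cyc(c_m σ⁻¹ c_m⁻¹ σ))/2` of `σ ∈ Σ_m`. -/
def permS2 {m : ℕ} (σ : Equiv.Perm (Fin m)) : ℕ :=
  (m - permCyc (finRotate m * σ⁻¹ * (finRotate m)⁻¹ * σ)) / 2

/-- The genus `S_1(σ) = ((m+1) − Cyc(c_{m+1} σ̂⁻¹ c_{m+1}⁻¹ σ̂))/2` of `σ ∈ Σ_m`. -/
def permS1 {m : ℕ} (σ : Equiv.Perm (Fin m)) : ℕ :=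
  ((m + 1) -
    permCyc (finRotate (m + 1) * (permHat σ)⁻¹ * (finRotate (m + 1))⁻¹ * permHat σ)) / 2

/-- The orbit count `permCyc` is the cardinality of the quotient by `SameCycle`. -/
theorem permCyc_eq_card {n : ℕ} (π : Equiv.Perm (Fin n)) :
    permCyc π = Nat.card (Quotient (Equiv.Perm.SameCycle.setoid π)) := by
  classical
  let F : Fin n → Equiv.Perm (Fin n) ⊕ Fin n := fun x =>
    if π x = x then Sum.inr x else Sum.inl (π.cycleOf x)
  have hker : ∀ x y, F x = F y ↔ π.SameCycle x y := by
    intro x y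
    simp only [F]
    by_cases hx : π x = x <;> by_cases hy : π y = y
    · rw [if_pos hx, if_pos hy, Sum.inr.injEq]
      exact ⟨fun h => h ▸ Equiv.Perm.SameCycle.refl _ _,
        fun h => h.eq_of_left hx⟩
    · rw [if_pos hx, if_neg hy]
      simp only [reduceCtorEq, false_iff]
      exact fun h => hy (h.apply_eq_self_iff.1 hx)
    · rw [if_neg hx, if_pos hy]
      simp only [reduceCtorEq, false_iff]
      exact fun h => hx (h.apply_eq_self_iff.2 hy)
    · rw [if_neg hx, if_neg hy, Sum.inl.injEq]
      exact (Equiv.Perm.sameCycle_iff_cycleOf_eq_of_mem_support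
        (Equiv.Perm.mem_support.2 hx) (Equiv.Perm.mem_support.2 hy)).symm
  have himage : Finset.univ.image F =
      π.cycleFactorsFinset.disjSum (Finset.univ.filter fun x => π x = x) := by
    ext (c | x)
    · simp only [Finset.mem_image, Finset.mem_univ, true_and, Finset.inl_mem_disjSum, F]
      constructor
      · rintro ⟨x, hx⟩
        split_ifs at hx with h
        obtain rfl := Sum.inl.inj hx
        exact Equiv.Perm.cycleOf_mem_cycleFactorsFinset_iff.2 (Equiv.Perm.mem_support.2 h)
      · intro hc
        obtain ⟨x, hx⟩ := (Equiv.Perm.mem_cycleFactorsFinset_iff.1 hc).1.nonempty_support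
        have hcx := Equiv.Perm.cycle_is_cycleOf hx hc
        have hπx := Equiv.Perm.mem_support.1
          (Equiv.Perm.mem_cycleFactorsFinset_support_le hc hx)
        exact ⟨x, by rw [if_neg hπx, hcx]⟩
    · simp only [Finset.mem_image, Finset.mem_univ, true_and, Finset.inr_mem_disjSum,
        Finset.mem_filter, F]
      constructor
      · rintro ⟨y, hy⟩
        split_ifs at hy with h
        exact Sum.inr.inj hy ▸ h
      · exact fun h => ⟨x, if_pos h⟩
  have hcard : permCyc π = (Finset.univ.image F).card := by
    rw [himage, Finset.card_disjSum, permCyc, Equiv.Perm.cycleType_def]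
    simp
  let G : Quotient (Equiv.Perm.SameCycle.setoid π) → Equiv.Perm (Fin n) ⊕ Fin n :=
    Quotient.lift F fun x y h => (hker x y).2 h
  have hG : Function.Injective G := by
    rintro ⟨x⟩ ⟨y⟩ h
    exact Quotient.sound ((hker x y).1 h)
  have hrange : Set.range G = ↑(Finset.univ.image F) := by
    rw [Finset.coe_image, Finset.coe_univ, Set.image_univ]
    exact Set.range_quot_lift _
  rw [hcard, ← Set.ncard_coe_finset, ← hrange, ← Set.image_univ,
    Set.ncard_image_of_injective _ hG, Set.ncard_univ]

/-- A function invariant under a permutation is constant on its cycles. -/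
theorem Equiv.Perm.SameCycle.map_eq_of_invariant {α β : Type*} {π : Equiv.Perm α} {f : α → β}
    (hf : ∀ x, f (π x) = f x) {x y : α} (h : π.SameCycle x y) : f x = f y := by
  obtain ⟨i, rfl⟩ := h
  induction i using Int.induction_on with
  | zero => rfl
  | succ i ih => rw [add_comm, zpow_add, zpow_one, Equiv.Perm.mul_apply, hf, ih]
  | pred i ih =>
    rw [ih, ← hf ((π ^ (-(i : ℤ) - 1)) x), ← Equiv.Perm.mul_apply, ← zpow_one_add]
    congr 3
    ring

/-- The range of an invariant function has at most as many elements as there are cycles. -/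
theorem ncard_range_le_permCyc {n : ℕ} {β : Type*} {π : Equiv.Perm (Fin n)} {f : Fin n → β}
    (hf : ∀ x, f (π x) = f x) : (Set.range f).ncard ≤ permCyc π := by
  rw [permCyc_eq_card]
  let g : Quotient (Equiv.Perm.SameCycle.setoid π) → β :=
    Quotient.lift f fun _ _ h => Equiv.Perm.SameCycle.map_eq_of_invariant hf h
  have : Set.range g = Set.range f := Set.range_quot_lift _
  rw [← this, ← Set.image_univ, ← Set.ncard_univ]
  exact Set.ncard_image_le

/-- A surjective invariant function onto the cycles of `ρ` bounds their number. -/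
theorem permCyc_le_of_surjective {n k : ℕ} {π : Equiv.Perm (Fin n)} {ρ : Equiv.Perm (Fin k)}
    {f : Fin n → Quotient (Equiv.Perm.SameCycle.setoid ρ)}
    (hf : ∀ x, f (π x) = f x) (hs : Function.Surjective f) : permCyc ρ ≤ permCyc π := by
  have := ncard_range_le_permCyc hf
  rwa [hs.range_eq, Set.ncard_univ, ← permCyc_eq_card] at this

/-- Multiplying by a transposition decreases the number of cycles by at most one. -/
theorem permCyc_le_mul_swap {n : ℕ} (π : Equiv.Perm (Fin n)) (a b : Fin n) :
    permCyc π ≤ permCyc (π * Equiv.swap a b) + 1 := by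
  classical
  let q : Fin n → Quotient (Equiv.Perm.SameCycle.setoid π) := Quotient.mk _
  let g : Fin n → Quotient (Equiv.Perm.SameCycle.setoid π) := fun x =>
    if q x = q b then q a else q x
  have hq : ∀ x, q (π x) = q x := fun x =>
    Quotient.sound (Equiv.Perm.sameCycle_apply_left.2 (Equiv.Perm.SameCycle.refl _ _))
  have hg : ∀ x, g ((π * Equiv.swap a b) x) = g x := by
    intro x
    simp only [g, Equiv.Perm.mul_apply, hq]
    rcases eq_or_ne x a with rfl | hxa
    · simp
    rcases eq_or_ne x b with rfl | hxb
    · simp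
    rw [Equiv.swap_apply_of_ne_of_ne hxa hxb]
  have hrange : Set.univ ⊆ insert (q b) (Set.range g) := by
    rintro ⟨x⟩ -
    by_cases hx : q x = q b
    · exact Or.inl hx
    · exact Or.inr ⟨x, if_neg hx⟩
  calc permCyc π = (Set.univ : Set (Quotient (Equiv.Perm.SameCycle.setoid π))).ncard := by
        rw [permCyc_eq_card, Set.ncard_univ]
    _ ≤ (insert (q b) (Set.range g)).ncard := Set.ncard_le_ncard hrange
    _ ≤ (Set.range g).ncard + 1 := Set.ncard_insert_le _ _
    _ ≤ _ := Nat.add_le_add_right (ncard_range_le_permCyc hg) 1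

/-- Multiplying by a transposition increases the number of cycles by at most one. -/
theorem permCyc_mul_swap_le {n : ℕ} (π : Equiv.Perm (Fin n)) (a b : Fin n) :
    permCyc (π * Equiv.swap a b) ≤ permCyc π + 1 := by
  simpa [mul_assoc] using permCyc_le_mul_swap (π * Equiv.swap a b) a b

/-- Skipping a point that is not fixed preserves the number of cycles. -/
theorem permCyc_eq_of_skip {n : ℕ} {ρ : Equiv.Perm (Fin n)} {π : Equiv.Perm (Fin (n + 1))}
    {a : Fin (n + 1)} (ha : π a ≠ a)
    (h : ∀ x, a.succAbove (ρ x) =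
      if π (a.succAbove x) = a then π a else π (a.succAbove x)) :
    permCyc ρ = permCyc π := by
  obtain ⟨p, hp⟩ := Fin.exists_succAbove_eq ha
  let qρ : Fin n → Quotient (Equiv.Perm.SameCycle.setoid ρ) := Quotient.mk _
  let qπ : Fin (n + 1) → Quotient (Equiv.Perm.SameCycle.setoid π) := Quotient.mk _
  have hqρ : ∀ x, qρ (ρ x) = qρ x := fun x =>
    Quotient.sound (Equiv.Perm.sameCycle_apply_left.2 (Equiv.Perm.SameCycle.refl _ _))
  have hqπ : ∀ x, qπ (π x) = qπ x := fun x =>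
    Quotient.sound (Equiv.Perm.sameCycle_apply_left.2 (Equiv.Perm.SameCycle.refl _ _))
  apply le_antisymm
  · let g : Fin (n + 1) → Quotient (Equiv.Perm.SameCycle.setoid ρ) :=
      a.insertNth (qρ p) qρ
    have hga : g a = qρ p := Fin.insertNth_apply_same ..
    have hge : ∀ x, g (a.succAbove x) = qρ x := fun x => Fin.insertNth_apply_succAbove ..
    refine permCyc_le_of_surjective (f := g) (fun x => ?_) ?_
    · rcases Fin.eq_self_or_eq_succAbove a x with rfl | ⟨x, rfl⟩
      · rw [← hp, hge, hga]
      · have hx := h x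
        split_ifs at hx with hxa
        · rw [hxa, hga, hge, ← hqρ x, Fin.succAbove_right_injective (hp.trans hx.symm)]
        · rw [← hx, hge, hge, hqρ]
    · rintro ⟨x⟩
      exact ⟨a.succAbove x, hge x⟩
  · refine permCyc_le_of_surjective (f := fun x => qπ (a.succAbove x)) (fun x => ?_) ?_
    · simp only [h]
      split_ifs with hxa
      · rw [hqπ, ← hqπ (a.succAbove x), hxa]
      · rw [hqπ]
    · rintro ⟨x⟩
      rcases Fin.eq_self_or_eq_succAbove a x with rfl | ⟨x, rfl⟩
      · exact ⟨p, by simp only [hp]; exact hqπ _⟩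
      · exact ⟨x, rfl⟩

/-- Skipping a point in the cyclic permutation gives the smaller cyclic permutation. -/
theorem succAbove_finRotate {n : ℕ} (a : Fin (n + 2)) (x : Fin (n + 1)) :
    a.succAbove (finRotate (n + 1) x) =
      if finRotate (n + 2) (a.succAbove x) = a then finRotate (n + 2) a
      else finRotate (n + 2) (a.succAbove x) := by
  have hval : ∀ (k : ℕ) (y : Fin (k + 1)),
      (finRotate (k + 1) y : ℕ) = if (y : ℕ) = k then 0 else (y : ℕ) + 1 := by
    intro k y
    rw [coe_finRotate]
    simp only [Fin.ext_iff, Fin.val_last]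
  have hsucc : (a.succAbove x : ℕ) = if (x : ℕ) < a then (x : ℕ) else (x : ℕ) + 1 := by
    simp only [Fin.succAbove, Fin.lt_def, Fin.val_castSucc]
    split_ifs <;> simp
  have hsucc' : (a.succAbove (finRotate (n + 1) x) : ℕ) =
      if (finRotate (n + 1) x : ℕ) < a then (finRotate (n + 1) x : ℕ)
      else (finRotate (n + 1) x : ℕ) + 1 := by
    simp only [Fin.succAbove, Fin.lt_def, Fin.val_castSucc]
    split_ifs <;> simp
  have hx := x.isLt
  have ha := a.isLt
  simp only [Fin.ext_iff, apply_ite Fin.val, hsucc']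
  simp only [hval, hsucc]
  split_ifs <;> omega

/-- The defining property of the face of a permutation. -/
theorem succAbove_permFace {n : ℕ} (σ : Equiv.Perm (Fin (n + 1))) (j : Fin (n + 1)) (x : Fin n) :
    (σ j).succAbove (permFace σ j x) = σ (j.succAbove x) := by
  have := congrArg Subtype.val ((finSuccAboveEquiv (σ j)).apply_symm_apply
    ((σ.subtypeEquiv (fun a => (σ.injective.ne_iff (x := a) (y := j)).symm))
      (finSuccAboveEquiv j x)))
  exact this

theorem permHat_zero {n : ℕ} (σ : Equiv.Perm (Fin n)) : permHat σ 0 = 0 := by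
  simp [permHat, Equiv.permCongr_apply]

theorem permHat_succ {n : ℕ} (σ : Equiv.Perm (Fin n)) (x : Fin n) :
    permHat σ x.succ = (σ x).succ := by
  simp [permHat, Equiv.permCongr_apply]

/-- The hat of a face is a face of the hat. -/
theorem succAbove_permHat_permFace {n : ℕ} (σ : Equiv.Perm (Fin (n + 1))) (j : Fin (n + 1))
    (x : Fin (n + 1)) :
    (permHat σ j.succ).succAbove (permHat (permFace σ j) x) =
      permHat σ (j.succ.succAbove x) := by
  rw [permHat_succ]
  cases x using Fin.cases with
  | zero => simp [permHat_zero]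
  | succ x => simp [permHat_succ, succAbove_permFace]

/-- If `τ'` is obtained from `τ` by deleting the point `a`, the numbers of cycles of the
commutators with the cyclic permutation agree up to a transposition. -/
theorem permCyc_commutator_of_skip {n : ℕ} {τ : Equiv.Perm (Fin (n + 2))}
    {τ' : Equiv.Perm (Fin (n + 1))} {a : Fin (n + 2)}
    (h : ∀ x, (τ a).succAbove (τ' x) = τ (a.succAbove x)) :
    permCyc (finRotate (n + 1) * τ'⁻¹ * (finRotate (n + 1))⁻¹ * τ') =
      permCyc (finRotate (n + 2) * τ⁻¹ * (finRotate (n + 2))⁻¹ * τ *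
        Equiv.swap a (τ⁻¹ (finRotate (n + 2) (τ a)))) := by
  set c := finRotate (n + 2) with hc
  set c' := finRotate (n + 1) with hc'
  have hca : c a ≠ a := by
    rw [hc, finRotate_apply]
    simp
  set E := c * τ⁻¹ * c⁻¹ * τ * Equiv.swap a (τ⁻¹ (c (τ a))) with hE
  have hEa : E a = c a := by simp [hE]
  refine permCyc_eq_of_skip (a := a) (hEa ▸ hca) fun x => ?_
  set z := τ'⁻¹ (c'⁻¹ (τ' x)) with hz
  have hτz : c' (τ' z) = τ' x := by simp [hz]
  have hskip := succAbove_finRotate (τ a) (τ' z)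
  rw [← hc', hτz, h, h, ← hc] at hskip
  have hEx : E (a.succAbove x) = c (a.succAbove z) := by
    rw [hE, Equiv.Perm.mul_apply]
    split_ifs at hskip with hk
    · have hb : τ⁻¹ (c (τ a)) = a.succAbove x := by rw [← hskip]; simp
      rw [hb, Equiv.swap_apply_right]
      simp [← hk]
    · have hb : a.succAbove x ≠ τ⁻¹ (c (τ a)) := by
        intro hb
        rw [hb, ← Equiv.Perm.mul_apply τ, mul_inv_cancel, Equiv.Perm.one_apply] at hskip
        exact Fin.succAbove_ne a z (τ.injective (c.injective hskip.symm))
      rw [Equiv.swap_apply_of_ne_of_ne (Fin.succAbove_ne a x) hb]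
      simp [hskip]
  rw [hEx, hEa]
  exact succAbove_finRotate a z

/-- For every `m ≥ 1`, every `σ ∈ Σ_{m+1}` and every `0 ≤ j ≤ m`, the
genus of a face satisfies `S_1 σ − 1 ≤ S_1 (∂_j σ) ≤ S_1 σ`. -/
theorem genus1_face (m : ℕ) (hm : 1 ≤ m) (σ : Equiv.Perm (Fin (m + 1))) (j : Fin (m + 1)) :
    (permS1 σ : ℤ) - 1 ≤ (permS1 (permFace σ j) : ℤ) ∧
    (permS1 (permFace σ j) : ℤ) ≤ (permS1 σ : ℤ) := by
  have h := permCyc_commutator_of_skip (n := m) (succAbove_permHat_permFace σ j)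
  have h₁ := permCyc_le_mul_swap (finRotate (m + 1 + 1) * (permHat σ)⁻¹ *
    (finRotate (m + 1 + 1))⁻¹ * permHat σ) j.succ
    ((permHat σ)⁻¹ (finRotate (m + 1 + 1) (permHat σ j.succ)))
  have h₂ := permCyc_mul_swap_le (finRotate (m + 1 + 1) * (permHat σ)⁻¹ *
    (finRotate (m + 1 + 1))⁻¹ * permHat σ) j.succ
    ((permHat σ)⁻¹ (finRotate (m + 1 + 1) (permHat σ j.succ)))
  rw [← h] at h₁ h₂
  unfold permS1
  omega
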